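/- Let S be a quasi completely regular semiring, let 𝒴* be the least congruence on S containing the relation 𝒴, and let ν be the least b-lattice-of-skew-rings congruence on S. Then 𝒴* ⊆ ν. -/

import Mathlib

/-- A "semiring" in the sense of the paper: both reducts are semigroups
(no commutativity, no identities) and multiplication distributes over
addition on both sides. -/
class PSemiring (S : Type*) extends AddSemigroup S, Semigroup S where
  left_distrib : ∀ a b c : S, a * (b + c) = a * b + a * c
  right_distrib : ∀ a b c : S, (a + b) * c = a * c + b * c

namespace PSemiring

variable {S : Type*} [PSemiring S]

/-- `nmul n a` is the `(n+1)`-fold sum `a + ⋯ + a`; thus the positive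
multiple `m·a` of the paper is `nmul (m-1) a`. -/
def nmul : ℕ → S → S
  | 0, a => a
  | n + 1, a => nmul n a + a

/-- `a` is additively regular. -/
def AddRegular (a : S) : Prop := ∃ x, a + x + a = a

/-- `a` is a completely regular element. -/
def CompletelyRegularElem (a : S) : Prop :=
  ∃ x, a = a + x + a ∧ a + x = x + a ∧ a * (a + x) = a + x

/-- `S` is a quasi completely regular semiring. -/
def QuasiCompletelyRegular (S : Type*) [PSemiring S] : Prop :=
  ∀ a : S, ∃ n : ℕ, CompletelyRegularElem (nmul n a)

/-- `S` is a completely regular semiring. -/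
def CompletelyRegularSemiring (S : Type*) [PSemiring S] : Prop :=
  ∀ a : S, CompletelyRegularElem a

/-- `e` is an additive idempotent (i.e. `e ∈ E⁺(S)`). -/
def AddIdem (e : S) : Prop := e + e = e

/-- `V⁺(a)`, the set of additive inverses of `a`. -/
def Vplus (a : S) : Set S := {x | a + x + a = a ∧ x + a + x = x}

/-- `{a} ∪ (S + a)`. -/
def lset (a : S) : Set S := insert a {x | ∃ s, x = s + a}

/-- `{a} ∪ (a + S)`. -/
def rset (a : S) : Set S := insert a {x | ∃ s, x = a + s}

/-- `{a} ∪ (S + a) ∪ (a + S) ∪ (S + a + S)`. -/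
def jset (a : S) : Set S :=
  insert a ({x | ∃ s, x = s + a} ∪ {x | ∃ s, x = a + s} ∪ {x | ∃ s t, x = s + a + t})

/-- Green's relation `L⁺` on the additive reduct. -/
def GreenL (a b : S) : Prop := lset a = lset b

/-- Green's relation `R⁺` on the additive reduct. -/
def GreenR (a b : S) : Prop := rset a = rset b

/-- Green's relation `J⁺` on the additive reduct. -/
def GreenJ (a b : S) : Prop := jset a = jset b

/-- `n` is the least index such that the `(n+1)`-fold sum of `a` is additively
regular, i.e. `(n+1)·a` is the least additively regular positive multiple. -/
def LeastReg (a : S) (n : ℕ) : Prop :=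
  AddRegular (nmul n a) ∧ ∀ m < n, ¬ AddRegular (nmul m a)

/-- The relation `L*⁺`. -/
def LStar (a b : S) : Prop :=
  ∃ p q, LeastReg a p ∧ LeastReg b q ∧ GreenL (nmul p a) (nmul q b)

/-- The relation `R*⁺`. -/
def RStar (a b : S) : Prop :=
  ∃ p q, LeastReg a p ∧ LeastReg b q ∧ GreenR (nmul p a) (nmul q b)

/-- The relation `J*⁺`. -/
def JStar (a b : S) : Prop :=
  ∃ p q, LeastReg a p ∧ LeastReg b q ∧ GreenJ (nmul p a) (nmul q b)

/-- `H*⁺ = L*⁺ ∩ R*⁺`. -/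
def HStar (a b : S) : Prop := LStar a b ∧ RStar a b

/-- `D*⁺ = L*⁺ ∘ R*⁺` (relational composition). -/
def DStar (a b : S) : Prop := ∃ c, LStar a c ∧ RStar c b

/-- `z = 0_a`: `z = na + x` where `n` is the least positive integer with `na`
completely regular and `x` is the (unique) element with `na = na+x+na`,
`x = x+na+x` and `na+x = x+na`. -/
def IsZeroOf (a z : S) : Prop :=
  ∃ n x, (CompletelyRegularElem (nmul n a) ∧
      ∀ m < n, ¬ CompletelyRegularElem (nmul m a)) ∧
    nmul n a = nmul n a + x + nmul n a ∧ x = x + nmul n a + x ∧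
    nmul n a + x = x + nmul n a ∧ z = nmul n a + x

/-- The relation `𝒴`, relative to a choice `z` of the map `a ↦ 0_a`. -/
def Yrel (z : S → S) (a b : S) : Prop := Vplus (a + z a) = Vplus (b + z b)

/-- A (semiring) congruence. -/
structure IsCong (r : S → S → Prop) : Prop where
  refl : ∀ a, r a a
  symm : ∀ {a b}, r a b → r b a
  trans : ∀ {a b c}, r a b → r b c → r a c
  addl : ∀ (c : S) {a b}, r a b → r (c + a) (c + b)
  addr : ∀ (c : S) {a b}, r a b → r (a + c) (b + c)
  mull : ∀ (c : S) {a b}, r a b → r (c * a) (c * b)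
  mulr : ∀ (c : S) {a b}, r a b → r (a * c) (b * c)

/-- `r` is a b-lattice congruence: `S/r` is a b-lattice. -/
def IsBLatticeCong (r : S → S → Prop) : Prop :=
  IsCong r ∧ (∀ a : S, r (a * a) a) ∧ (∀ a : S, r (a + a) a) ∧
    ∀ a b : S, r (a + b) (b + a)

/-- `r` is the least b-lattice congruence. -/
def IsLeastBLatticeCong (r : S → S → Prop) : Prop :=
  IsBLatticeCong r ∧ ∀ r', IsBLatticeCong r' → ∀ a b, r a b → r' a b

/-- `r` is a skew-ring congruence: `S/r` is a semiring whose additive reduct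
is a group (expressed by solvability of both translation equations). -/
def IsSkewRingCong (r : S → S → Prop) : Prop :=
  IsCong r ∧ ∀ a b : S, (∃ x, r (a + x) b) ∧ ∃ y, r (y + a) b

/-- `r` is the least skew-ring congruence. -/
def IsLeastSkewRingCong (r : S → S → Prop) : Prop :=
  IsSkewRingCong r ∧ ∀ r', IsSkewRingCong r' → ∀ a b, r a b → r' a b

/-- `η` is a b-lattice-of-skew-rings congruence: `S/η` admits a congruence `ξ`
(given here as a congruence on `S` containing `η`) such that `(S/η)/ξ` is a
b-lattice and every `ξ`-class of `S/η` is a subsemiring whose additive reduct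
is a group. -/
def IsBLSRCong (η : S → S → Prop) : Prop :=
  IsCong η ∧ ∃ ξ : S → S → Prop, IsCong ξ ∧ (∀ a b, η a b → ξ a b) ∧
    (∀ a : S, ξ (a * a) a) ∧ (∀ a : S, ξ (a + a) a) ∧
    (∀ a b : S, ξ (a + b) (b + a)) ∧
    (∀ a b, ξ a b → ξ (a + b) a ∧ ξ (a * b) a) ∧
    ∀ a b, ξ a b → (∃ x, ξ x a ∧ η (a + x) b) ∧ ∃ y, ξ y a ∧ η (y + a) b

/-- `ν` is the least b-lattice-of-skew-rings congruence. -/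
def IsLeastBLSRCong (ν : S → S → Prop) : Prop :=
  IsBLSRCong ν ∧ ∀ η, IsBLSRCong η → ∀ a b, ν a b → η a b

/-- `r` is a completely regular semiring congruence: `S/r` is completely
regular. -/
def IsCRCong (r : S → S → Prop) : Prop :=
  IsCong r ∧ ∀ a : S, ∃ x, r a (a + x + a) ∧ r (a + x) (x + a) ∧
    r (a * (a + x)) (a + x)

/-- `ρ` is the least completely regular semiring congruence. -/
def IsLeastCRCong (r : S → S → Prop) : Prop :=
  IsCRCong r ∧ ∀ r', IsCRCong r' → ∀ a b, r a b → r' a b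

/-- `S` is quasi-orthodox. -/
def QuasiOrthodox (S : Type*) [PSemiring S] : Prop :=
  ∀ e f : S, AddIdem e → AddIdem f →
    ∃ n : ℕ, nmul n (e + f) = nmul (n + 1) (e + f)

/-- `S` is a completely Archimedean semiring. -/
def CompletelyArchimedean (S : Type*) [PSemiring S] : Prop :=
  QuasiCompletelyRegular S ∧ ∀ a b : S, JStar a b

/-- `r` is the least congruence containing the relation `τ`. -/
def IsLeastCongContaining (τ r : S → S → Prop) : Prop :=
  IsCong r ∧ (∀ a b, τ a b → r a b) ∧
    ∀ r', IsCong r' → (∀ a b, τ a b → r' a b) → ∀ a b, r a b → r' a b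

/-- `r` is a generalized additive idempotent pure congruence (purity part). -/
def GenAddIdemPure (r : S → S → Prop) : Prop :=
  ∀ a e : S, AddIdem e → r a e → ∃ n : ℕ, nmul n a = nmul (n + 1) a

/-- `τ^e`: `a = x + c + y`, `b = x + d + y` for some `(c,d) ∈ τ`, where each of
`x`, `y` may also be absent (i.e. `x, y ∈ S⁰`). -/
def relE (τ : S → S → Prop) (a b : S) : Prop :=
  ∃ c d, τ c d ∧ ((a = c ∧ b = d) ∨ (∃ x, a = x + c ∧ b = x + d) ∨
    (∃ y, a = c + y ∧ b = d + y) ∨ ∃ x y, a = x + c + y ∧ b = x + d + y)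

/-- `τ^♮`: the transitive closure of `(τ ∪ τ⁻¹ ∪ ε)^e`. -/
def natClosure (τ : S → S → Prop) : S → S → Prop :=
  Relation.TransGen (relE (fun a b => τ a b ∨ τ b a ∨ a = b))

end PSemiring

namespace PSemiring

variable {S : Type*} [PSemiring S]

theorem nmul_add_comm (n : ℕ) (a : S) : a + nmul n a = nmul n a + a := by
  induction n with
  | zero => rfl
  | succ n ih => rw [nmul, ← add_assoc, ih]

theorem exists_add_eq_nmul_add_nmul (n : ℕ) (a : S) :
    ∃ w, a + w = nmul n a + nmul n a := by
  cases n with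
  | zero => exact ⟨a, rfl⟩
  | succ n => exact ⟨nmul n a + nmul (n + 1) a, by
      rw [← add_assoc, nmul_add_comm, nmul]⟩

theorem IsZeroOf.addIdem {a z : S} (h : IsZeroOf a z) : AddIdem z := by
  obtain ⟨n, x, -, hm, -, -, rfl⟩ := h
  rw [AddIdem, ← add_assoc, ← hm]

theorem IsZeroOf.add_comm {a z : S} (h : IsZeroOf a z) : a + z = z + a := by
  obtain ⟨n, x, -, hm, -, hmx, rfl⟩ := h
  have ha := nmul_add_comm n a
  generalize nmul n a = m at *
  have hl : m + x + (a + (m + x)) = a + (m + x) := by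
    rw [← add_assoc a, ha, ← add_assoc, ← add_assoc, ← hm]
  have hr : m + x + a + (m + x) = m + x + a := by
    calc m + x + a + (m + x) = x + m + a + (x + m) := by rw [hmx]
      _ = x + (m + a) + (x + m) := by rw [add_assoc x]
      _ = x + a + (m + x + m) := by rw [← ha]; simp only [add_assoc]
      _ = m + x + a := by rw [← hm, add_assoc x, ha, ← add_assoc, hmx]
  rw [← hl, ← add_assoc, hr]

theorem IsZeroOf.vplus_nonempty {a z : S} (h : IsZeroOf a z) :
    (Vplus (a + z)).Nonempty := by
  have hz : z + z = z := h.addIdem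
  have haz := h.add_comm
  obtain ⟨n, x, -, hm, -, hmx, hzx⟩ := h
  obtain ⟨w, hw⟩ := exists_add_eq_nmul_add_nmul n a
  generalize nmul n a = m at *
  have hmm : m + m + x + x = z := by
    rw [add_assoc m m x, hmx, ← add_assoc, ← hm, hzx, hmx]
  have hinv : a + z + (z + w + x + x + z) = z := by
    calc a + z + (z + w + x + x + z) = a + (z + z) + w + x + x + z := by
          simp only [add_assoc]
      _ = z + (a + w + x + x) + z := by
          rw [hz, haz]
          simp only [add_assoc]
      _ = z := by rw [hw, hmm, hz, hz]
  refine ⟨z + w + x + x + z, ?_, ?_⟩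
  · rw [hinv, haz, ← add_assoc, hz]
  · rw [add_assoc, hinv, add_assoc, hz]

variable {η ξ : S → S → Prop}

theorem IsCong.of_mem_Vplus (hξ : IsCong ξ) (hidem : ∀ a, ξ (a + a) a)
    (hcomm : ∀ a b, ξ (a + b) (b + a)) {p c : S} (h : c ∈ Vplus p) : ξ p c := by
  have absorb : ∀ {u v : S}, u + v + u = u → ξ u (u + v) := fun {u v} huv => by
    have h₁ := hξ.addl u (hcomm v u)
    have h₂ := hξ.addr v (hidem u)
    rw [← add_assoc, ← add_assoc, huv] at h₁
    exact hξ.trans h₁ h₂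
  exact hξ.trans (absorb h.1) (hξ.trans (hcomm p c) (hξ.symm (absorb h.2)))

theorem IsCong.nmul (hξ : IsCong ξ) (hidem : ∀ a, ξ (a + a) a) (n : ℕ) (a : S) :
    ξ (nmul n a) a := by
  induction n with
  | zero => exact hξ.refl a
  | succ n ih => exact hξ.trans (hξ.addr a ih) (hidem a)

theorem IsZeroOf.rel_of_isCong {a z : S} (h : IsZeroOf a z) (hξ : IsCong ξ)
    (hidem : ∀ a, ξ (a + a) a) (hcomm : ∀ a b, ξ (a + b) (b + a)) : ξ z a := by
  obtain ⟨n, x, -, hm, hx, -, rfl⟩ := h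
  have hmx := hξ.of_mem_Vplus hidem hcomm (⟨hm.symm, hx.symm⟩ : x ∈ Vplus (PSemiring.nmul n a))
  exact hξ.trans (hξ.addl _ (hξ.symm hmx)) (hξ.trans (hidem _) (hξ.nmul hidem n a))

theorem IsCong.add_addIdem (hη : IsCong η) {a e y : S} (he : AddIdem e)
    (hy : η (y + e) a) : η (a + e) a := by
  have h := hη.addr e hy
  rw [add_assoc, he] at h
  exact hη.trans (hη.symm h) hy

theorem IsCong.addIdem_add (hη : IsCong η) {a e x : S} (he : AddIdem e)
    (hx : η (e + x) a) : η (e + a) a := by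
  have h := hη.addl e hx
  rw [← add_assoc, he] at h
  exact hη.trans (hη.symm h) hx

theorem IsBLSRCong.of_yrel (h : IsBLSRCong η) {z : S → S} (hz : ∀ a, IsZeroOf a (z a))
    {a b : S} (hab : Yrel z a b) : η a b := by
  obtain ⟨hη, ξ, hξ, -, -, hidem, hcomm, -, hsolve⟩ := h
  have hright : ∀ {u e : S}, AddIdem e → ξ e u → η (u + e) u := fun he heu =>
    let ⟨_, _, hy⟩ := (hsolve _ _ heu).2
    hη.add_addIdem he hy
  have hleft : ∀ {u e : S}, AddIdem e → ξ e u → η (e + u) u := fun he heu =>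
    let ⟨_, _, hx⟩ := (hsolve _ _ heu).1
    hη.addIdem_add he hx
  have hzero : ∀ u, η (u + z u) u := fun u =>
    hright (hz u).addIdem ((hz u).rel_of_isCong hξ hidem hcomm)
  refine hη.trans (hη.symm (hzero a)) (hη.trans ?_ (hzero b))
  obtain ⟨c, hp⟩ := (hz a).vplus_nonempty
  have hq : c ∈ Vplus (b + z b) := hab ▸ hp
  generalize a + z a = p at *
  generalize b + z b = q at *
  have hpc := hξ.of_mem_Vplus hidem hcomm hp
  have hqc := hξ.of_mem_Vplus hidem hcomm hq
  have hcq : ξ (c + q) p :=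
    hξ.trans (hξ.addl c hqc) (hξ.trans (hidem c) (hξ.symm hpc))
  have hpc' : ξ (p + c) q :=
    hξ.trans (hξ.addr c hpc) (hξ.trans (hidem c) (hξ.symm hqc))
  have h₁ : η (p + (c + q)) p := hright (by rw [AddIdem, ← add_assoc, hq.2]) hcq
  have h₂ : η (p + c + q) q := hleft (by rw [AddIdem, ← add_assoc, hp.1]) hpc'
  rw [← add_assoc] at h₁
  exact hη.trans (hη.symm h₁) h₂

end PSemiring

open PSemiring

/-- In a quasi completely regular semiring, `𝒴* ⊆ ν`, where `𝒴*`
is the least congruence containing `𝒴` and `ν` is the least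
b-lattice-of-skew-rings congruence. -/
theorem ystar_subset_nu {S : Type*} [PSemiring S]
    (hS : QuasiCompletelyRegular S) (z : S → S) (hz : ∀ a, IsZeroOf a (z a))
    (Ystar : S → S → Prop) (hY : IsLeastCongContaining (Yrel z) Ystar)
    (ν : S → S → Prop) (hν : IsLeastBLSRCong ν) :
    ∀ a b : S, Ystar a b → ν a b :=
  hY.2.2 ν hν.1.1 fun _ _ => hν.1.of_yrel hz
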